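/- For every J = (j_1, …, j_r) ∈ ℤ^r and every δ ∈ C_J, the set S_{δ,J} of ≼-minimal nontrivial simple elements satisfying property P(δ,J) has at most n − 1 elements. -/

import Mathlib

/-- The braid relations on `n` strands, with Artin generators indexed by `Fin (n-1)`:
`σᵢ σⱼ σᵢ = σⱼ σᵢ σⱼ` when `|i - j| = 1`, and `σᵢ σⱼ = σⱼ σᵢ` when `|i - j| ≥ 2`. -/
def braidRels (n : ℕ) : Set (FreeGroup (Fin (n - 1))) :=
  {w | (∃ i j : Fin (n - 1), (i : ℕ) + 1 = (j : ℕ) ∧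
          w = FreeGroup.of i * FreeGroup.of j * FreeGroup.of i *
              (FreeGroup.of j * FreeGroup.of i * FreeGroup.of j)⁻¹) ∨
       (∃ i j : Fin (n - 1), (i : ℕ) + 1 < (j : ℕ) ∧
          w = FreeGroup.of i * FreeGroup.of j * (FreeGroup.of j * FreeGroup.of i)⁻¹)}

/-- The braid group `B_n` on `n` strands. -/
abbrev BraidGroup (n : ℕ) := PresentedGroup (braidRels n)

/-- The Artin generator `σᵢ` of the braid group. -/
def braidGen (n : ℕ) (i : Fin (n - 1)) : BraidGroup n := PresentedGroup.of i

/-- The monoid `B_n⁺` of positive braids: products of the generators with no inverses. -/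
def PosBraid (n : ℕ) : Submonoid (BraidGroup n) :=
  Submonoid.closure (Set.range (braidGen n))

/-- Prefix order (left-divisibility): `a ≼ b` iff `a * c = b` for some positive `c`. -/
def PrefixLE (n : ℕ) (a b : BraidGroup n) : Prop :=
  ∃ c ∈ PosBraid n, a * c = b

/-- The Garside half-twist `Δ = (σ₁)(σ₂σ₁)⋯(σ_{n-1}⋯σ₁)`. -/
def braidDelta (n : ℕ) : BraidGroup n :=
  ((List.finRange (n - 1)).map (fun k =>
      ((((List.finRange (n - 1)).filter (fun i => decide (i ≤ k))).reverse.map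
        (braidGen n)).prod))).prod

/-- A simple element (permutation braid): a positive braid left-dividing `Δ`. -/
def IsSimple (n : ℕ) (s : BraidGroup n) : Prop :=
  s ∈ PosBraid n ∧ PrefixLE n s (braidDelta n)

/-- `InfGE n j a` means `inf(a) ≥ j`, i.e. `a = Δ^j p` for some positive braid `p`. -/
def InfGE (n : ℕ) (j : ℤ) (a : BraidGroup n) : Prop :=
  ∃ p ∈ PosBraid n, a = braidDelta n ^ j * p

/-- `β ∈ C^inf(α)`: `inf(β i) ≥ inf(α i)` for all `i` and `β` is simultaneously
conjugate to `α`. -/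
def CInf (n r : ℕ) (α β : Fin r → BraidGroup n) : Prop :=
  (∀ i, ∀ j : ℤ, InfGE n j (α i) → InfGE n j (β i)) ∧
  ∃ ω : BraidGroup n, ∀ i, β i = ω⁻¹ * α i * ω

/-- `δ ∈ C_J`: `inf(δ i) ≥ J i` for all `i`. -/
def CJ (n r : ℕ) (J : Fin r → ℤ) (δ : Fin r → BraidGroup n) : Prop :=
  ∀ i, InfGE n (J i) (δ i)

/-- Property `P(δ,J)` for a braid `s`: `inf(s⁻¹ δᵢ s) ≥ J i` for all `i`,
i.e. `s⁻¹ δ s ∈ C_J`. -/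
def PropP (n r : ℕ) (J : Fin r → ℤ) (δ : Fin r → BraidGroup n) (s : BraidGroup n) : Prop :=
  ∀ i, InfGE n (J i) (s⁻¹ * δ i * s)

/-- `s ∈ S_{δ,J}`: `s` is ≼-minimal among the nontrivial simple elements
satisfying `P(δ,J)`. -/
def MinSimple (n r : ℕ) (J : Fin r → ℤ) (δ : Fin r → BraidGroup n) (s : BraidGroup n) : Prop :=
  IsSimple n s ∧ s ≠ 1 ∧ PropP n r J δ s ∧
    ∀ t : BraidGroup n, IsSimple n t → t ≠ 1 → PropP n r J δ t → PrefixLE n t s → t = s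

/-- `d` is a greatest common left-divisor of `u` and `v` in `B_n⁺`. -/
def IsGCD (n : ℕ) (u v d : BraidGroup n) : Prop :=
  d ∈ PosBraid n ∧ PrefixLE n d u ∧ PrefixLE n d v ∧
    ∀ c ∈ PosBraid n, PrefixLE n c u → PrefixLE n c v → PrefixLE n c d

/-- `m` is a least common left-multiple of `u` and `v` in `B_n⁺`. -/
def IsLCM (n : ℕ) (u v m : BraidGroup n) : Prop :=
  m ∈ PosBraid n ∧ PrefixLE n u m ∧ PrefixLE n v m ∧
    ∀ c ∈ PosBraid n, PrefixLE n u c → PrefixLE n v c → PrefixLE n m c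

/-- The defining relations of the braid monoid with `N` generators. -/
def posBraidRel (N : ℕ) (v w : FreeMonoid (Fin N)) : Prop :=
  (∃ i j : Fin N, (i : ℕ) + 1 = (j : ℕ) ∧
      v = FreeMonoid.of i * FreeMonoid.of j * FreeMonoid.of i ∧
      w = FreeMonoid.of j * FreeMonoid.of i * FreeMonoid.of j) ∨
    (∃ i j : Fin N, (i : ℕ) + 1 < (j : ℕ) ∧
      v = FreeMonoid.of i * FreeMonoid.of j ∧ w = FreeMonoid.of j * FreeMonoid.of i)

/-- The monoid presented by the braid relations. -/
abbrev BraidMonoid (N : ℕ) := PresentedMonoid (posBraidRel N)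

namespace BraidMonoid

variable {N : ℕ}

/-- The generators of the braid monoid. -/
def gen (i : Fin N) : BraidMonoid N := PresentedMonoid.of _ i

/-- The indices of two generators satisfying a relation of length three. -/
def Adj (i j : Fin N) : Prop := (i : ℕ) + 1 = j ∨ (j : ℕ) + 1 = i

/-- The indices of two distinct commuting generators. -/
def Far (i j : Fin N) : Prop := (i : ℕ) + 1 < j ∨ (j : ℕ) + 1 < i

theorem Adj.symm {i j : Fin N} (h : Adj i j) : Adj j i := Or.symm h

theorem Far.symm {i j : Fin N} (h : Far i j) : Far j i := Or.symm h

theorem eq_or_far_or_adj (i j : Fin N) : i = j ∨ Far i j ∨ Adj i j := by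
  unfold Far Adj; omega

theorem gen_comm {i j : Fin N} (h : Far i j) : gen i * gen j = gen j * gen i := by
  rcases h with h | h
  · exact PresentedMonoid.mk_eq_mk_of_rel (Or.inr ⟨i, j, h, rfl, rfl⟩)
  · exact (PresentedMonoid.mk_eq_mk_of_rel (Or.inr ⟨j, i, h, rfl, rfl⟩)).symm

theorem gen_braid {i j : Fin N} (h : Adj i j) :
    gen i * gen j * gen i = gen j * gen i * gen j := by
  rcases h with h | h
  · exact PresentedMonoid.mk_eq_mk_of_rel (Or.inl ⟨i, j, h, rfl, rfl⟩)
  · exact (PresentedMonoid.mk_eq_mk_of_rel (Or.inl ⟨j, i, h, rfl, rfl⟩)).symm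

theorem gen_comm_mul {i j : Fin N} (h : Far i j) (x : BraidMonoid N) :
    gen i * (gen j * x) = gen j * (gen i * x) := by
  simp only [← mul_assoc, gen_comm h]

theorem gen_braid_mul {i j : Fin N} (h : Adj i j) (x : BraidMonoid N) :
    gen i * (gen j * (gen i * x)) = gen j * (gen i * (gen j * x)) := by
  simp only [← mul_assoc, gen_braid h]

theorem induction {p : BraidMonoid N → Prop} (one : p 1)
    (gen_mul : ∀ i x, p x → p (gen i * x)) (x : BraidMonoid N) : p x := by
  refine PresentedMonoid.inductionOn x fun a => ?_
  induction a using FreeMonoid.recOn with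
  | one => exact one
  | of_mul i a h => exact gen_mul i _ h

/-- The length of an element of the braid monoid. -/
def length : BraidMonoid N →* Multiplicative ℕ :=
  PresentedMonoid.lift (fun _ => Multiplicative.ofAdd 1) <| by
    rintro a b (⟨i, j, -, rfl, rfl⟩ | ⟨i, j, -, rfl, rfl⟩) <;> simp

/-- The length of an element of the braid monoid, as a natural number. -/
def len (x : BraidMonoid N) : ℕ := (length x).toAdd

theorem len_mul (x y : BraidMonoid N) : len (x * y) = len x + len y := by simp [len]

theorem len_gen (i : Fin N) : len (gen i) = 1 := rfl

/-- The pairs `(u, v)` for which `gen i * u = gen j * v` follows from the least common multiple of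
`gen i` and `gen j`. -/
def Completes (i j : Fin N) (u v : BraidMonoid N) : Prop :=
  (i = j ∧ u = v) ∨
  (Far i j ∧ ∃ w, u = gen j * w ∧ v = gen i * w) ∨
  (Adj i j ∧ ∃ w, u = gen j * (gen i * w) ∧ v = gen i * (gen j * w))

theorem Completes.symm {i j : Fin N} {u v : BraidMonoid N} (h : Completes i j u v) :
    Completes j i v u := by
  rcases h with ⟨rfl, rfl⟩ | ⟨h, w, rfl, rfl⟩ | ⟨h, w, rfl, rfl⟩
  · exact Or.inl ⟨rfl, rfl⟩
  · exact Or.inr (Or.inl ⟨h.symm, w, rfl, rfl⟩)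
  · exact Or.inr (Or.inr ⟨h.symm, w, rfl, rfl⟩)

theorem Completes.mul {i j : Fin N} {u v : BraidMonoid N} (h : Completes i j u v)
    (x : BraidMonoid N) : Completes i j (u * x) (v * x) := by
  rcases h with ⟨rfl, rfl⟩ | ⟨h, w, rfl, rfl⟩ | ⟨h, w, rfl, rfl⟩
  · exact Or.inl ⟨rfl, rfl⟩
  · exact Or.inr (Or.inl ⟨h, w * x, by simp only [mul_assoc], by simp only [mul_assoc]⟩)
  · exact Or.inr (Or.inr ⟨h, w * x, by simp only [mul_assoc], by simp only [mul_assoc]⟩)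

theorem Completes.len_eq {i j : Fin N} {u v : BraidMonoid N} (h : Completes i j u v) :
    len u = len v := by
  rcases h with ⟨rfl, rfl⟩ | ⟨h, w, rfl, rfl⟩ | ⟨h, w, rfl, rfl⟩ <;> simp only [len_mul, len_gen]

/-- In length less than `m`, common multiples of generators are multiples of their least common
multiple. -/
def CompletesBelow (N m : ℕ) : Prop :=
  ∀ (i j : Fin N) (x y : BraidMonoid N), len x < m → gen i * x = gen j * y → Completes i j x y

theorem CompletesBelow.cancel {m : ℕ} (hm : CompletesBelow N m) {i : Fin N} {x y : BraidMonoid N}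
    (hx : len x < m) (h : gen i * x = gen i * y) : x = y := by
  rcases hm i i x y hx h with ⟨-, h⟩ | ⟨h, -⟩ | ⟨h, -⟩
  · exact h
  · unfold Far at h; omega
  · unfold Adj at h; omega

theorem CompletesBelow.far {m : ℕ} (hm : CompletesBelow N m) {i j : Fin N} {x y : BraidMonoid N}
    (hij : Far i j) (hx : len x < m) (h : gen i * x = gen j * y) :
    ∃ w, x = gen j * w ∧ y = gen i * w := by
  rcases hm i j x y hx h with ⟨rfl, -⟩ | ⟨-, h⟩ | ⟨h, -⟩
  · unfold Far at hij; omega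
  · exact h
  · unfold Far at hij; unfold Adj at h; omega

theorem CompletesBelow.adj {m : ℕ} (hm : CompletesBelow N m) {i j : Fin N} {x y : BraidMonoid N}
    (hij : Adj i j) (hx : len x < m) (h : gen i * x = gen j * y) :
    ∃ w, x = gen j * (gen i * w) ∧ y = gen i * (gen j * w) := by
  rcases hm i j x y hx h with ⟨rfl, -⟩ | ⟨h, -⟩ | ⟨-, h⟩
  · unfold Adj at hij; omega
  · unfold Far at h; unfold Adj at hij; omega
  · exact h

theorem Completes.trans_far_far {m : ℕ} (hm : CompletesBelow N m) {a b c : Fin N}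
    {u z v : BraidMonoid N} (hu : len u ≤ m) (hab : Far a b) (hbc : Far b c)
    (h₁ : Completes a b u z) (h₂ : Completes b c z v) : Completes a c u v := by
  obtain ⟨w, rfl, rfl⟩ : ∃ w, u = gen b * w ∧ z = gen a * w := by
    rcases h₁ with ⟨h, -⟩ | ⟨-, h⟩ | ⟨h, -⟩
    · unfold Far at hab; omega
    · exact h
    · unfold Far at hab; unfold Adj at h; omega
  obtain ⟨w', hw, rfl⟩ : ∃ w', gen a * w = gen c * w' ∧ v = gen b * w' := by
    rcases h₂ with ⟨h, -⟩ | ⟨-, h⟩ | ⟨h, -⟩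
    · unfold Far at hbc; omega
    · exact h
    · unfold Far at hbc; unfold Adj at h; omega
  simp only [len_mul, len_gen] at hu
  rcases hm a c w w' (by omega) hw with ⟨h, rfl⟩ | ⟨h, x, rfl, rfl⟩ | ⟨h, x, rfl, rfl⟩
  · exact Or.inl ⟨h, rfl⟩
  · exact Or.inr (Or.inl ⟨h, gen b * x, gen_comm_mul hbc x, gen_comm_mul hab.symm x⟩)
  · refine Or.inr (Or.inr ⟨h, gen b * x, ?_, ?_⟩)
    · rw [gen_comm_mul hbc, gen_comm_mul hab]
    · rw [gen_comm_mul hab.symm, gen_comm_mul hbc]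

theorem Completes.trans_adj_far {m : ℕ} (hm : CompletesBelow N m) {a b c : Fin N}
    {u z v : BraidMonoid N} (hu : len u ≤ m) (hab : Adj a b) (hbc : Far b c)
    (h₁ : Completes a b u z) (h₂ : Completes b c z v) : Completes a c u v := by
  obtain ⟨w, rfl, rfl⟩ : ∃ w, u = gen b * (gen a * w) ∧ z = gen a * (gen b * w) := by
    rcases h₁ with ⟨h, -⟩ | ⟨h, -⟩ | ⟨-, h⟩
    · unfold Adj at hab; omega
    · unfold Far at h; unfold Adj at hab; omega
    · exact h
  obtain ⟨w', hw, rfl⟩ : ∃ w', gen a * (gen b * w) = gen c * w' ∧ v = gen b * w' := by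
    rcases h₂ with ⟨h, -⟩ | ⟨-, h⟩ | ⟨h, -⟩
    · unfold Far at hbc; omega
    · exact h
    · unfold Far at hbc; unfold Adj at h; omega
  simp only [len_mul, len_gen] at hu
  rcases eq_or_far_or_adj a c with rfl | h | h
  · unfold Far at hbc; unfold Adj at hab; omega
  · obtain ⟨x, hx, rfl⟩ := hm.far h (by simp only [len_mul, len_gen]; omega) hw
    obtain ⟨y, rfl, rfl⟩ := hm.far hbc (by omega) hx
    refine Or.inr (Or.inl ⟨h, gen b * (gen a * y), ?_, ?_⟩)
    · rw [gen_comm_mul h, gen_comm_mul hbc]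
    · rw [gen_braid_mul hab]
  · obtain ⟨x, hx, rfl⟩ := hm.adj h (by simp only [len_mul, len_gen]; omega) hw
    have hl := congrArg len hx
    simp only [len_mul, len_gen] at hl
    obtain ⟨y, rfl, hy⟩ := hm.far hbc (by omega) hx
    simp only [len_mul, len_gen] at hl hu
    obtain ⟨e, rfl, rfl⟩ := hm.adj hab (by omega) hy
    refine Or.inr (Or.inr ⟨h, gen b * (gen a * (gen c * e)), ?_, ?_⟩)
    · rw [gen_braid_mul h, gen_comm_mul hbc.symm, gen_comm_mul hbc, gen_braid_mul hab.symm]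
    · rw [gen_comm_mul hbc.symm, ← gen_braid_mul hab, gen_braid_mul h, gen_comm_mul hbc]

theorem Completes.trans_adj_adj {m : ℕ} (hm : CompletesBelow N m) {a b c : Fin N}
    {u z v : BraidMonoid N} (hu : len u ≤ m) (hab : Adj a b) (hbc : Adj b c)
    (h₁ : Completes a b u z) (h₂ : Completes b c z v) : Completes a c u v := by
  obtain ⟨w, rfl, rfl⟩ : ∃ w, u = gen b * (gen a * w) ∧ z = gen a * (gen b * w) := by
    rcases h₁ with ⟨h, -⟩ | ⟨h, -⟩ | ⟨-, h⟩
    · unfold Adj at hab; omega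
    · unfold Far at h; unfold Adj at hab; omega
    · exact h
  obtain ⟨w', hw, rfl⟩ : ∃ w', gen a * (gen b * w) = gen c * (gen b * w') ∧
      v = gen b * (gen c * w') := by
    rcases h₂ with ⟨h, -⟩ | ⟨h, -⟩ | ⟨-, h⟩
    · unfold Adj at hbc; omega
    · unfold Far at h; unfold Adj at hbc; omega
    · exact h
  have hl := congrArg len hw
  simp only [len_mul, len_gen] at hu hl
  rcases eq_or_far_or_adj a c with rfl | h | h
  · have h₃ := hm.cancel (by simp only [len_mul, len_gen]; omega) hw
    exact Or.inl ⟨rfl, by rw [hm.cancel (by omega) h₃]⟩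
  · obtain ⟨x, hx, hx'⟩ := hm.far h (by simp only [len_mul, len_gen]; omega) hw
    obtain ⟨y, rfl, rfl⟩ := hm.adj hbc (by omega) hx
    obtain ⟨y', rfl, hy⟩ := hm.adj hab.symm (by omega) hx'
    simp only [len_mul, len_gen] at hu hl
    have hy := hm.cancel (by simp only [len_mul, len_gen]; omega) hy
    obtain ⟨e, rfl, rfl⟩ := hm.far h.symm (by omega) hy
    refine Or.inr (Or.inl ⟨h, gen b * (gen c * (gen a * (gen b * e))), ?_, ?_⟩)
    · rw [gen_comm_mul h, gen_braid_mul hab, gen_braid_mul hbc]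
    · rw [gen_comm_mul h.symm, gen_braid_mul hbc.symm, gen_braid_mul hab.symm, gen_comm_mul h]
  · unfold Adj at hab hbc h; omega

theorem Completes.trans {m : ℕ} (hm : CompletesBelow N m) {a b c : Fin N}
    {u z v : BraidMonoid N} (hu : len u ≤ m)
    (h₁ : Completes a b u z) (h₂ : Completes b c z v) : Completes a c u v := by
  have hv : len v ≤ m := by rwa [← h₂.len_eq, ← h₁.len_eq]
  rcases eq_or_far_or_adj a b with rfl | hab | hab
  · rcases h₁ with ⟨-, rfl⟩ | ⟨h, -⟩ | ⟨h, -⟩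
    · exact h₂
    · unfold Far at h; omega
    · unfold Adj at h; omega
  all_goals
    rcases eq_or_far_or_adj b c with rfl | hbc | hbc
    · rcases h₂ with ⟨-, rfl⟩ | ⟨h, -⟩ | ⟨h, -⟩
      · exact h₁
      · unfold Far at h; omega
      · unfold Adj at h; omega
  · exact trans_far_far hm hu hab hbc h₁ h₂
  · exact (trans_adj_far hm hv hbc.symm hab.symm h₂.symm h₁.symm).symm
  · exact trans_adj_far hm hu hab hbc h₁ h₂
  · exact trans_adj_adj hm hu hab hbc h₁ h₂

theorem of_mul_inj {i j : Fin N} {x y : FreeMonoid (Fin N)}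
    (h : FreeMonoid.of i * x = FreeMonoid.of j * y) : i = j ∧ x = y := by
  have h := congrArg FreeMonoid.toList h
  simpa using h

theorem len_mk (v : FreeMonoid (Fin N)) : len (PresentedMonoid.mk _ v) = v.length := by
  induction v using FreeMonoid.recOn with
  | one => rfl
  | of_mul i v h => rw [map_mul, len_mul, h, FreeMonoid.length_mul]; rfl

theorem length_eq_of_rel {v w : FreeMonoid (Fin N)} (h : ConGen.Rel (posBraidRel N) v w) :
    v.length = w.length := by
  rw [← len_mk, ← len_mk, PresentedMonoid.mk_eq_mk_iff.2 h]

theorem eq_one_or_eq_of_mul (v : FreeMonoid (Fin N)) :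
    v = 1 ∨ ∃ i w, v = FreeMonoid.of i * w := by
  cases v using FreeMonoid.casesOn with
  | one => exact Or.inl rfl
  | of_mul i w => exact Or.inr ⟨i, w, rfl⟩

theorem completes_of_rel {m : ℕ} (hm : CompletesBelow N m) {v w : FreeMonoid (Fin N)}
    (h : ConGen.Rel (posBraidRel N) v w) (hv : v.length ≤ m + 1) (i j : Fin N)
    (x y : FreeMonoid (Fin N)) (hx : v = FreeMonoid.of i * x) (hy : w = FreeMonoid.of j * y) :
    Completes i j (PresentedMonoid.mk _ x) (PresentedMonoid.mk _ y) := by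
  induction h generalizing i j x y with
  | of v w h =>
    rcases h with ⟨a, b, h, rfl, rfl⟩ | ⟨a, b, h, rfl, rfl⟩
    · rw [mul_assoc] at hx hy
      obtain ⟨rfl, rfl⟩ := of_mul_inj hx
      obtain ⟨rfl, rfl⟩ := of_mul_inj hy
      exact Or.inr (Or.inr ⟨Or.inl h, 1, rfl, rfl⟩)
    · obtain ⟨rfl, rfl⟩ := of_mul_inj hx
      obtain ⟨rfl, rfl⟩ := of_mul_inj hy
      exact Or.inr (Or.inl ⟨Or.inl h, 1, rfl, rfl⟩)
  | refl v =>
    obtain ⟨rfl, rfl⟩ := of_mul_inj (hx.symm.trans hy)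
    exact Or.inl ⟨rfl, rfl⟩
  | symm h ih => exact (ih (by rwa [length_eq_of_rel h]) j i y x hy hx).symm
  | @trans v w z h₁ h₂ ih₁ ih₂ =>
    have hvw := length_eq_of_rel h₁
    rcases eq_one_or_eq_of_mul w with rfl | ⟨k, t, rfl⟩
    · rw [hx, FreeMonoid.length_mul, FreeMonoid.length_of, FreeMonoid.length_one] at hvw
      omega
    · refine (ih₁ hv i k x t hx rfl).trans hm ?_ (ih₂ (hvw ▸ hv) k j t y rfl hy)
      rw [hx, FreeMonoid.length_mul, FreeMonoid.length_of] at hv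
      rw [len_mk]
      omega
  | @mul v w y' z' h₁ h₂ ih₁ ih₂ =>
    have hvw := length_eq_of_rel h₁
    rw [FreeMonoid.length_mul] at hv
    rcases eq_one_or_eq_of_mul v with rfl | ⟨k, t, rfl⟩
    · obtain rfl : w = 1 := FreeMonoid.length_eq_zero.1 hvw.symm
      rw [one_mul] at hx hy
      exact ih₂ (by omega) i j x y hx hy
    · rcases eq_one_or_eq_of_mul w with rfl | ⟨l, u, rfl⟩
      · rw [FreeMonoid.length_mul, FreeMonoid.length_of, FreeMonoid.length_one] at hvw
        omega
      rw [mul_assoc] at hx hy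
      obtain ⟨rfl, rfl⟩ := of_mul_inj hx
      obtain ⟨rfl, rfl⟩ := of_mul_inj hy
      rw [map_mul, map_mul, ← PresentedMonoid.mk_eq_mk_iff.2 h₂]
      exact (ih₁ (by omega) k l t u rfl rfl).mul _

/-- Common multiples of two generators are multiples of their least common multiple. -/
theorem completes_of_gen_mul_eq {i j : Fin N} {x y : BraidMonoid N}
    (h : gen i * x = gen j * y) : Completes i j x y := by
  suffices ∀ m, CompletesBelow N m from this (len x + 1) i j x y (Nat.lt_succ_self _) h
  clear h x y i j
  intro m
  induction m with
  | zero => intro i j x y h; omega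
  | succ m hm =>
    intro i j x y hx h
    obtain ⟨v, rfl⟩ := PresentedMonoid.surjective_mk x
    obtain ⟨w, rfl⟩ := PresentedMonoid.surjective_mk y
    refine completes_of_rel hm (v := FreeMonoid.of i * v) (w := FreeMonoid.of j * w)
      (PresentedMonoid.mk_eq_mk_iff.1 h) ?_ i j v w rfl rfl
    rw [len_mk] at hx
    rw [FreeMonoid.length_mul, FreeMonoid.length_of]
    omega

theorem mul_left_cancel' (a : BraidMonoid N) {x y : BraidMonoid N} (h : a * x = a * y) :
    x = y := by
  induction a using induction with
  | one => simpa using h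
  | gen_mul i a ih =>
    rw [mul_assoc, mul_assoc] at h
    rcases completes_of_gen_mul_eq h with ⟨-, h⟩ | ⟨h, -⟩ | ⟨h, -⟩
    · exact ih h
    · unfold Far at h; omega
    · unfold Adj at h; omega

end BraidMonoid

section HalfTwist

variable {X : Type*} [Monoid X]

/-- The product `s (k-1) * ⋯ * s 1 * s 0`. -/
def descProd (s : ℕ → X) : ℕ → X
  | 0 => 1
  | k + 1 => s k * descProd s k

/-- The half-twist on the generators `s 0, …, s (k-1)`. -/
def halfTwist (s : ℕ → X) : ℕ → X
  | 0 => 1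
  | k + 1 => halfTwist s k * descProd s (k + 1)

/-- The first `N` terms of `s` satisfy the braid relations. -/
structure IsBraided (s : ℕ → X) (N : ℕ) : Prop where
  braid : ∀ i, i + 1 < N → s i * s (i + 1) * s i = s (i + 1) * s i * s (i + 1)
  comm : ∀ i j, i + 1 < j → j < N → Commute (s i) (s j)

namespace IsBraided

variable {s : ℕ → X} {N : ℕ}

theorem commute_descProd (hs : IsBraided s N) {k j : ℕ} (hkj : k < j) (hj : j < N) :
    Commute (descProd s k) (s j) := by
  induction k with
  | zero => exact Commute.one_left _
  | succ k ih => exact (hs.comm k j hkj hj).mul_left (ih (by omega))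

theorem commute_halfTwist (hs : IsBraided s N) {k j : ℕ} (hkj : k < j) (hj : j < N) :
    Commute (halfTwist s k) (s j) := by
  induction k with
  | zero => exact Commute.one_left _
  | succ k ih => exact (ih (by omega)).mul_left (hs.commute_descProd hkj hj)

theorem descProd_mul (hs : IsBraided s N) {k i : ℕ} (hi : i + 1 < k) (hk : k ≤ N) :
    descProd s k * s (i + 1) = s i * descProd s k := by
  induction k with
  | zero => omega
  | succ k ih =>
    rcases Nat.lt_or_ge (i + 1) k with h | h
    · rw [descProd, mul_assoc, ih h (by omega), ← mul_assoc, ← mul_assoc,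
        (hs.comm i k h (by omega)).eq]
    · obtain rfl : k = i + 1 := by omega
      have hc := (hs.commute_descProd (Nat.lt_succ_self i) (by omega)).eq
      simp only [descProd, mul_assoc, hc]
      simp only [← mul_assoc, hs.braid i (by omega)]

theorem descProd_mul_descProd_shift (hs : IsBraided s N) {k j : ℕ} (hj : j ≤ k) (hk : k < N) :
    descProd s (k + 1) * descProd (fun i => s (i + 1)) j =
      descProd s j * descProd s (k + 1) := by
  induction j with
  | zero => simp [descProd]
  | succ j ih =>
    rw [descProd.eq_2 _ j, ← mul_assoc, hs.descProd_mul (by omega) (by omega), mul_assoc,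
      ih (by omega), ← mul_assoc]
    rfl

theorem descProd_mul_halfTwist_shift (hs : IsBraided s N) {k j : ℕ} (hj : j ≤ k) (hk : k < N) :
    descProd s (k + 1) * halfTwist (fun i => s (i + 1)) j =
      halfTwist s j * descProd s (k + 1) := by
  induction j with
  | zero => simp [halfTwist]
  | succ j ih =>
    rw [halfTwist, ← mul_assoc, ih (by omega), mul_assoc, hs.descProd_mul_descProd_shift hj hk,
      ← mul_assoc]
    rfl

theorem dvd_halfTwist (hs : IsBraided s N) {k i : ℕ} (hi : i < k) (hk : k ≤ N) :
    s i ∣ halfTwist s k := by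
  induction k with
  | zero => omega
  | succ k ih =>
    rcases Nat.lt_or_ge i k with h | h
    · exact (ih h (by omega)).mul_right _
    · obtain rfl : i = k := by omega
      rw [halfTwist, ← hs.descProd_mul_halfTwist_shift le_rfl (by omega), descProd, mul_assoc]
      exact dvd_mul_right _ _

theorem descProd_mul_descProd (hs : IsBraided s N) {k j : ℕ} (hj : j ≤ k) (hk : k < N) :
    descProd s (k + 1) * descProd s (j + 1) = descProd s j * descProd s (k + 1) * s 0 := by
  induction j with
  | zero => simp [descProd]
  | succ j ih =>
    rw [descProd.eq_2 s (j + 1), ← mul_assoc, hs.descProd_mul (by omega) (by omega), mul_assoc,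
      ih (by omega), descProd.eq_2 s j]
    simp only [mul_assoc]

theorem halfTwist_mul (hs : IsBraided s N) {k i j : ℕ} (hij : i + j + 1 = k) (hk : k ≤ N) :
    halfTwist s k * s i = s j * halfTwist s k := by
  induction k generalizing i j with
  | zero => omega
  | succ k ih =>
    rcases i with _ | i
    · obtain rfl : j = k := by omega
      rcases j with _ | k
      · simp [halfTwist, descProd]
      · calc halfTwist s k * descProd s (k + 1) * descProd s (k + 2) * s 0
          _ = halfTwist s k * (descProd s (k + 1) * descProd s (k + 2) * s 0) := by
            simp only [mul_assoc]
          _ = halfTwist s k * s (k + 1) * descProd s (k + 1) * descProd s (k + 2) := by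
            rw [← hs.descProd_mul_descProd le_rfl (by omega), descProd.eq_2 s (k + 1)]
            simp only [mul_assoc]
          _ = s (k + 1) * (halfTwist s k * descProd s (k + 1) * descProd s (k + 2)) := by
            rw [(hs.commute_halfTwist (Nat.lt_succ_self k) (by omega)).eq]
            simp only [mul_assoc]
    · rw [halfTwist, mul_assoc, hs.descProd_mul (by omega) hk, ← mul_assoc,
        ih (j := j) (by omega) (by omega), mul_assoc]

end IsBraided

theorem map_descProd {Y : Type*} [Monoid Y] (f : X →* Y) (s : ℕ → X) (k : ℕ) :
    f (descProd s k) = descProd (fun i => f (s i)) k := by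
  induction k with
  | zero => exact map_one f
  | succ k ih => rw [descProd, map_mul, ih]; rfl

theorem map_halfTwist {Y : Type*} [Monoid Y] (f : X →* Y) (s : ℕ → X) (k : ℕ) :
    f (halfTwist s k) = halfTwist (fun i => f (s i)) k := by
  induction k with
  | zero => exact map_one f
  | succ k ih => rw [halfTwist, map_mul, ih, map_descProd]; rfl

theorem descProd_eq_prod (s : ℕ → X) (k : ℕ) :
    descProd s k = ((List.range k).reverse.map s).prod := by
  induction k with
  | zero => rfl
  | succ k ih => simp [List.range_succ, descProd, ih]

theorem halfTwist_eq_prod (s : ℕ → X) (k : ℕ) :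
    halfTwist s k = ((List.range k).map fun i => descProd s (i + 1)).prod := by
  induction k with
  | zero => rfl
  | succ k ih => simp [List.range_succ, halfTwist, ih]

end HalfTwist

namespace BraidMonoid

variable {N : ℕ}

/-- The generators of the braid monoid, extended by `1`. -/
def natGen (N k : ℕ) : BraidMonoid N := if h : k < N then gen ⟨k, h⟩ else 1

theorem natGen_val (i : Fin N) : natGen N i = gen i := dif_pos i.2

theorem isBraided_natGen (N : ℕ) : IsBraided (natGen N) N where
  braid i h := by
    rw [natGen, natGen, dif_pos (by omega), dif_pos h]
    exact gen_braid (Or.inl rfl)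
  comm i j hij hj := by
    rw [natGen, natGen, dif_pos (by omega), dif_pos hj]
    exact gen_comm (Or.inl hij)

/-- The half-twist of the braid monoid. -/
def delta (N : ℕ) : BraidMonoid N := halfTwist (natGen N) N

theorem delta_mul_gen (i : Fin N) : delta N * gen i = gen i.rev * delta N := by
  rw [← natGen_val, ← natGen_val]
  exact (isBraided_natGen N).halfTwist_mul (by rw [Fin.val_rev]; omega) le_rfl

theorem commute_delta_sq (x : BraidMonoid N) : Commute (delta N ^ 2) x := by
  induction x using induction with
  | one => exact Commute.one_right _
  | gen_mul i x ih =>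
    refine Commute.mul_right ?_ ih
    rw [Commute, SemiconjBy, pow_two, mul_assoc, delta_mul_gen, ← mul_assoc, delta_mul_gen,
      Fin.rev_rev, mul_assoc]

theorem dvd_delta_sq_pow (x : BraidMonoid N) : ∃ k : ℕ, x ∣ (delta N ^ 2) ^ k := by
  induction x using induction with
  | one => exact ⟨0, one_dvd _⟩
  | gen_mul i x ih =>
    obtain ⟨k, q, hq⟩ := ih
    obtain ⟨y, hy⟩ : gen i ∣ delta N ^ 2 := by
      rw [pow_two, ← natGen_val]
      exact ((isBraided_natGen N).dvd_halfTwist i.2 le_rfl).mul_right _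
    refine ⟨k + 1, q * y, ?_⟩
    rw [mul_assoc, ← mul_assoc x, ← hq, ((commute_delta_sq y).pow_left k).eq, ← mul_assoc, ← hy,
      pow_succ']

theorem exists_mul_eq_delta_sq_pow (x : BraidMonoid N) :
    ∃ (k : ℕ) (q : BraidMonoid N), q * x = (delta N ^ 2) ^ k := by
  obtain ⟨k, q, hq⟩ := dvd_delta_sq_pow x
  refine ⟨k, q, mul_left_cancel' x ?_⟩
  rw [← mul_assoc, ← hq, ((commute_delta_sq x).pow_left k).eq]

theorem mul_right_cancel' {x y : BraidMonoid N} (a : BraidMonoid N) (h : x * a = y * a) :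
    x = y := by
  obtain ⟨k, q, hq⟩ := dvd_delta_sq_pow a
  apply mul_left_cancel' ((delta N ^ 2) ^ k)
  rw [((commute_delta_sq x).pow_left k).eq, ((commute_delta_sq y).pow_left k).eq, hq, ← mul_assoc,
    ← mul_assoc, h]

theorem exists_mul_eq_mul (r s : BraidMonoid N) : ∃ a b : BraidMonoid N, b * r = a * s := by
  obtain ⟨k, q, hq⟩ := exists_mul_eq_delta_sq_pow s
  exact ⟨r * q, (delta N ^ 2) ^ k, by rw [((commute_delta_sq r).pow_left k).eq, mul_assoc, hq]⟩

noncomputable instance : OreLocalization.OreSet (⊤ : Submonoid (BraidMonoid N)) where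
  ore_right_cancel r₁ r₂ s h := ⟨1, by rw [mul_right_cancel' _ h]⟩
  oreNum r s := (exists_mul_eq_mul r s).choose
  oreDenom r s := ⟨(exists_mul_eq_mul r s).choose_spec.choose, Submonoid.mem_top _⟩
  ore_eq r s := (exists_mul_eq_mul r s).choose_spec.choose_spec

theorem numeratorHom_injective : Function.Injective
    (OreLocalization.numeratorHom (S := (⊤ : Submonoid (BraidMonoid N)))) := by
  intro x y h
  obtain ⟨u, v, h₁, h₂⟩ := OreLocalization.oreDiv_eq_iff.1 h
  simp only [OneMemClass.coe_one, mul_one] at h₂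
  rw [Submonoid.smul_def, smul_eq_mul, smul_eq_mul, h₂] at h₁
  exact (mul_left_cancel' v h₁).symm

/-- The canonical map from the braid monoid to the braid group. -/
def toGroup (n : ℕ) : BraidMonoid (n - 1) →* BraidGroup n :=
  PresentedMonoid.lift (braidGen n) <| by
    rintro a b (⟨i, j, h, rfl, rfl⟩ | ⟨i, j, h, rfl, rfl⟩)
    · simp only [map_mul, FreeMonoid.lift_eval_of]
      rw [← mul_inv_eq_one]
      exact PresentedGroup.one_of_mem (rels := braidRels n) (Or.inl ⟨i, j, h, rfl⟩)
    · simp only [map_mul, FreeMonoid.lift_eval_of]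
      rw [← mul_inv_eq_one]
      exact PresentedGroup.one_of_mem (rels := braidRels n) (Or.inr ⟨i, j, h, rfl⟩)

theorem toGroup_gen (n : ℕ) (i : Fin (n - 1)) : toGroup n (gen i) = braidGen n i := rfl

theorem toGroup_injective (n : ℕ) : Function.Injective (toGroup n) := by
  let ν := OreLocalization.numeratorHom (S := (⊤ : Submonoid (BraidMonoid (n - 1))))
  let f : Fin (n - 1) → (OreLocalization (⊤ : Submonoid (BraidMonoid (n - 1)))
      (BraidMonoid (n - 1)))ˣ :=
    fun i => OreLocalization.numeratorUnit ⟨gen i, Submonoid.mem_top _⟩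
  have hf : ∀ i, (f i : OreLocalization _ _) = ν (gen i) := fun _ => rfl
  have hrel : ∀ r ∈ braidRels n, FreeGroup.lift f r = 1 := by
    rintro r (⟨i, j, h, rfl⟩ | ⟨i, j, h, rfl⟩)
    · simp only [map_mul, map_inv, FreeGroup.lift_apply_of]
      rw [mul_inv_eq_one]
      ext
      simp only [Units.val_mul, hf, ← map_mul, gen_braid (Or.inl h : Adj i j)]
    · simp only [map_mul, map_inv, FreeGroup.lift_apply_of]
      rw [mul_inv_eq_one]
      ext
      simp only [Units.val_mul, hf, ← map_mul, gen_comm (Or.inl h : Far i j)]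
  have hν : ((Units.coeHom _).comp (PresentedGroup.toGroup hrel)).comp (toGroup n) = ν := by
    refine PresentedMonoid.ext _ fun i => ?_
    change Units.val (PresentedGroup.toGroup hrel (PresentedGroup.of i)) = _
    rw [PresentedGroup.toGroup.of]
    rfl
  refine Function.Injective.of_comp (f := (Units.coeHom _).comp (PresentedGroup.toGroup hrel)) ?_
  rw [← MonoidHom.coe_comp, hν]
  exact numeratorHom_injective

theorem mem_posBraid_iff {n : ℕ} {p : BraidGroup n} :
    p ∈ PosBraid n ↔ ∃ x, toGroup n x = p := by
  have : PosBraid n = MonoidHom.mrange (toGroup n) := by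
    rw [MonoidHom.mrange_eq_map, ← PresentedMonoid.closure_range_of, MonoidHom.map_mclosure,
      ← Set.range_comp]
    rfl
  rw [this, MonoidHom.mem_mrange]

theorem filter_le_range (m k : ℕ) :
    (List.range m).filter (fun i => decide (i ≤ k)) = List.range (min m (k + 1)) := by
  induction m with
  | zero => simp
  | succ m ih =>
    rw [List.range_succ, List.filter_append, ih]
    rcases Nat.lt_or_ge k m with h | h
    · rw [min_eq_right (by omega), min_eq_right (by omega)]
      simp [h]
    · rw [min_eq_left (by omega), min_eq_left (by omega), List.range_succ]
      simp [h]

theorem toGroup_delta (n : ℕ) : toGroup n (delta (n - 1)) = braidDelta n := by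
  have hgen : braidGen n = (fun i => toGroup n (natGen (n - 1) i)) ∘ Fin.val := by
    funext i
    rw [Function.comp_apply, natGen_val, toGroup_gen]
  rw [delta, map_halfTwist, halfTwist_eq_prod, braidDelta, ← List.map_coe_finRange_eq_range,
    List.map_map]
  congr 1
  refine List.map_congr_left fun k _ => ?_
  have hfilter : List.map Fin.val
      ((List.finRange (n - 1)).filter fun i => decide (i ≤ k)) = List.range (k + 1) := by
    rw [← min_eq_right (show (k : ℕ) + 1 ≤ n - 1 from k.2), ← filter_le_range,
      ← List.map_coe_finRange_eq_range, List.filter_map]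
    rfl
  rw [Function.comp_apply, descProd_eq_prod, ← hfilter, hgen, ← List.map_reverse, List.map_map]

end BraidMonoid

open BraidMonoid

variable {n : ℕ}

theorem prefixLE_iff {a b : BraidGroup n} : PrefixLE n a b ↔ a⁻¹ * b ∈ PosBraid n :=
  ⟨by rintro ⟨c, hc, rfl⟩; simpa using hc, fun h => ⟨_, h, mul_inv_cancel_left a b⟩⟩

theorem PrefixLE.refl (a : BraidGroup n) : PrefixLE n a a := ⟨1, one_mem _, mul_one a⟩

theorem PrefixLE.trans {a b c : BraidGroup n} (hab : PrefixLE n a b) (hbc : PrefixLE n b c) :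
    PrefixLE n a c := by
  obtain ⟨x, hx, rfl⟩ := hab
  obtain ⟨y, hy, rfl⟩ := hbc
  exact ⟨x * y, mul_mem hx hy, (mul_assoc a x y).symm⟩

theorem PrefixLE.mul_left {a b : BraidGroup n} (h : PrefixLE n a b) (c : BraidGroup n) :
    PrefixLE n (c * a) (c * b) := by
  obtain ⟨x, hx, rfl⟩ := h
  exact ⟨x, hx, mul_assoc c a x⟩

theorem prefixLE_mul_left_iff {a b c : BraidGroup n} :
    PrefixLE n (c * a) (c * b) ↔ PrefixLE n a b :=
  ⟨fun h => by simpa using h.mul_left c⁻¹, fun h => h.mul_left c⟩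

theorem one_prefixLE_iff {a : BraidGroup n} : PrefixLE n 1 a ↔ a ∈ PosBraid n := by
  rw [prefixLE_iff, inv_one, one_mul]

theorem toGroup_mem (x : BraidMonoid (n - 1)) : toGroup n x ∈ PosBraid n :=
  mem_posBraid_iff.2 ⟨x, rfl⟩

theorem BraidMonoid.eq_one_of_len_eq_zero {N : ℕ} {x : BraidMonoid N} (h : len x = 0) : x = 1 := by
  induction x using BraidMonoid.induction with
  | one => rfl
  | gen_mul i x _ => rw [len_mul, len_gen] at h; omega

theorem PrefixLE.antisymm {a b : BraidGroup n} (hab : PrefixLE n a b) (hba : PrefixLE n b a) :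
    a = b := by
  obtain ⟨p, hp, rfl⟩ := hab
  obtain ⟨q, hq, h⟩ := hba
  obtain ⟨x, rfl⟩ := mem_posBraid_iff.1 hp
  obtain ⟨y, rfl⟩ := mem_posBraid_iff.1 hq
  rw [mul_assoc, mul_eq_left, ← map_mul, ← map_one (toGroup n)] at h
  have hl := congrArg len (toGroup_injective n h)
  rw [len_mul] at hl
  have h1 : len (1 : BraidMonoid (n - 1)) = 0 := rfl
  rw [eq_one_of_len_eq_zero (x := x) (by omega), map_one, mul_one]

/-- `m` is a least upper bound of `a` and `b` for the prefix order on the braid group. -/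
def IsPrefixJoin (n : ℕ) (a b m : BraidGroup n) : Prop :=
  PrefixLE n a m ∧ PrefixLE n b m ∧ ∀ p, PrefixLE n a p → PrefixLE n b p → PrefixLE n m p

theorem exists_isPrefixJoin_gen (i j : Fin (n - 1)) :
    ∃ m, IsPrefixJoin n (braidGen n i) (braidGen n j) m := by
  have key : ∀ p, PrefixLE n (braidGen n i) p → PrefixLE n (braidGen n j) p →
      ∃ x y, p = toGroup n (gen i * x) ∧ Completes i j x y := by
    rintro p ⟨a, ha, rfl⟩ ⟨b, hb, h⟩
    obtain ⟨x, rfl⟩ := mem_posBraid_iff.1 ha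
    obtain ⟨y, rfl⟩ := mem_posBraid_iff.1 hb
    rw [← toGroup_gen, ← toGroup_gen, ← map_mul, ← map_mul] at h
    exact ⟨x, y, by rw [map_mul, toGroup_gen],
      completes_of_gen_mul_eq (toGroup_injective n h).symm⟩
  rcases eq_or_far_or_adj i j with rfl | hij | hij
  · exact ⟨braidGen n i, .refl _, .refl _, fun p hp _ => hp⟩
  · refine ⟨toGroup n (gen i * gen j), ⟨toGroup n (gen j), toGroup_mem _, (map_mul _ _ _).symm⟩,
      ⟨toGroup n (gen i), toGroup_mem _, ?_⟩, fun p hi hj => ?_⟩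
    · rw [gen_comm hij, map_mul, toGroup_gen, toGroup_gen]
    · obtain ⟨x, y, rfl, ⟨rfl, -⟩ | ⟨-, w, rfl, -⟩ | ⟨h, -⟩⟩ := key p hi hj
      · unfold Far at hij; omega
      · exact ⟨toGroup n w, toGroup_mem _, by rw [← map_mul, mul_assoc]⟩
      · unfold Far at hij; unfold Adj at h; omega
  · refine ⟨toGroup n (gen i * gen j * gen i),
      ⟨toGroup n (gen j * gen i), toGroup_mem _, ?_⟩,
      ⟨toGroup n (gen i * gen j), toGroup_mem _, ?_⟩, fun p hi hj => ?_⟩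
    · rw [mul_assoc, map_mul _ (gen i), toGroup_gen]
    · rw [gen_braid hij, mul_assoc, map_mul _ (gen j), toGroup_gen]
    · obtain ⟨x, y, rfl, ⟨rfl, -⟩ | ⟨h, -⟩ | ⟨-, w, rfl, -⟩⟩ := key p hi hj
      · unfold Adj at hij; omega
      · unfold Adj at hij; unfold Far at h; omega
      · exact ⟨toGroup n w, toGroup_mem _, by rw [← map_mul]; simp only [mul_assoc]⟩

theorem PrefixLE.eq_or_mul_gen {x a : BraidGroup n} (h : PrefixLE n x a) :
    a = x ∨ ∃ i, PrefixLE n (x * braidGen n i) a := by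
  obtain ⟨p, hp, rfl⟩ := h
  obtain ⟨y, rfl⟩ := mem_posBraid_iff.1 hp
  induction y using BraidMonoid.induction with
  | one => exact Or.inl (by rw [map_one, mul_one])
  | gen_mul i y _ =>
    exact Or.inr ⟨i, toGroup n y, toGroup_mem _, by rw [map_mul, toGroup_gen, mul_assoc]⟩

theorem exists_isPrefixJoin_of_len (l : ℕ) (x a b u : BraidGroup n) (w : BraidMonoid (n - 1))
    (hw : x * toGroup n w = u) (hl : len w ≤ l) (hxa : PrefixLE n x a) (hxb : PrefixLE n x b)
    (hau : PrefixLE n a u) (hbu : PrefixLE n b u) : ∃ m, IsPrefixJoin n a b m := by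
  induction l generalizing x a b w with
  | zero =>
    obtain rfl : w = 1 := eq_one_of_len_eq_zero (by omega)
    obtain rfl : x = u := by rwa [map_one, mul_one] at hw
    obtain rfl := hau.antisymm hxa
    obtain rfl := hbu.antisymm hxb
    exact ⟨_, .refl _, .refl _, fun p hp _ => hp⟩
  | succ l ih =>
    rcases hxa.eq_or_mul_gen with rfl | ⟨i, hi⟩
    · exact ⟨b, hxb, .refl _, fun p _ hp => hp⟩
    rcases hxb.eq_or_mul_gen with rfl | ⟨j, hj⟩
    · exact ⟨a, .refl _, hxa, fun p hp _ => hp⟩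
    have shorten : ∀ k, PrefixLE n (x * braidGen n k) u →
        ∃ w', x * braidGen n k * toGroup n w' = u ∧ len w' ≤ l := by
      rintro k ⟨p, hp, hpu⟩
      obtain ⟨w', rfl⟩ := mem_posBraid_iff.1 hp
      refine ⟨w', hpu, ?_⟩
      rw [← hw, mul_assoc, mul_right_inj, ← toGroup_gen, ← map_mul] at hpu
      rw [← toGroup_injective n hpu, len_mul, len_gen] at hl
      omega
    obtain ⟨wi, hwi, hli⟩ := shorten i (hi.trans hau)
    obtain ⟨wj, hwj, hlj⟩ := shorten j (hj.trans hbu)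
    obtain ⟨m₀, him, hjm, hm⟩ := exists_isPrefixJoin_gen i j
    have hm : ∀ p, PrefixLE n (x * braidGen n i) p → PrefixLE n (x * braidGen n j) p →
        PrefixLE n (x * m₀) p := by
      intro p hip hjp
      rw [← mul_inv_cancel_left x p, prefixLE_mul_left_iff] at hip hjp ⊢
      exact hm _ hip hjp
    obtain ⟨a', haa', hma', ha'⟩ :=
      ih _ a (x * m₀) wi hwi hli hi (him.mul_left x) hau (hm u (hi.trans hau) (hj.trans hbu))
    obtain ⟨m, ham, hbm, hmm⟩ := ih _ a' b wj hwj hlj ((hjm.mul_left x).trans hma') hj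
      (ha' u hau (hm u (hi.trans hau) (hj.trans hbu))) hbu
    exact ⟨m, haa'.trans ham, hbm, fun p hap hbp =>
      hmm p (ha' p hap (hm p (hi.trans hap) (hj.trans hbp))) hbp⟩

/-- Two braids with a common lower bound and a common upper bound for the prefix order have a least
upper bound. -/
theorem exists_isPrefixJoin {x a b u : BraidGroup n} (hxa : PrefixLE n x a) (hxb : PrefixLE n x b)
    (hau : PrefixLE n a u) (hbu : PrefixLE n b u) : ∃ m, IsPrefixJoin n a b m := by
  obtain ⟨p, hp, hpu⟩ := hxa.trans hau
  obtain ⟨w, rfl⟩ := mem_posBraid_iff.1 hp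
  exact exists_isPrefixJoin_of_len _ x a b u w hpu le_rfl hxa hxb hau hbu

theorem commute_braidDelta_sq (g : BraidGroup n) : Commute (braidDelta n ^ 2) g := by
  suffices h : g ∈ Subgroup.centralizer {braidDelta n ^ 2} from
    (Subgroup.mem_centralizer_iff.1 h _ rfl)
  refine PresentedGroup.generated_by _ _ (fun i => ?_) g
  rw [Subgroup.mem_centralizer_iff]
  rintro _ rfl
  rw [← toGroup_delta, ← map_pow]
  exact ((commute_delta_sq (gen i)).map (toGroup n)).eq

theorem exists_delta_sq_pow_mul_mem (g : BraidGroup n) :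
    ∃ k : ℕ, (braidDelta n ^ 2) ^ k * g ∈ PosBraid n := by
  obtain ⟨z, rfl⟩ := PresentedGroup.mk_surjective _ g
  induction z using FreeGroup.induction_on with
  | C1 => exact ⟨0, by simp⟩
  | of i => exact ⟨0, by rw [pow_zero, one_mul]; exact toGroup_mem (gen i)⟩
  | inv_of i _ =>
    obtain ⟨k, q, hq⟩ := exists_mul_eq_delta_sq_pow (gen i)
    refine ⟨k, mem_posBraid_iff.2 ⟨q, ?_⟩⟩
    rw [← toGroup_delta, ← map_pow, ← map_pow, ← hq, map_mul, map_inv]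
    exact (mul_inv_cancel_right _ _).symm
  | mul a b ha hb =>
    obtain ⟨k, hk⟩ := ha
    obtain ⟨l, hl⟩ := hb
    refine ⟨k + l, ?_⟩
    have := mul_mem hk hl
    rwa [mul_assoc, ← mul_assoc (PresentedGroup.mk _ a),
      ← ((commute_braidDelta_sq (PresentedGroup.mk _ a)).pow_left l).eq, mul_assoc, ← mul_assoc,
      ← pow_add, ← map_mul] at this

theorem exists_prefixLE_of_mem {d : BraidGroup n} (hd : d ∈ PosBraid n) (c : BraidGroup n) :
    ∃ x, PrefixLE n x c ∧ PrefixLE n x d := by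
  obtain ⟨k, hk⟩ := exists_delta_sq_pow_mul_mem c
  refine ⟨((braidDelta n ^ 2) ^ k)⁻¹, prefixLE_iff.2 (by rwa [inv_inv]),
    prefixLE_iff.2 (by
      rw [inv_inv]
      refine mul_mem (pow_mem (pow_mem ?_ 2) k) hd
      rw [← toGroup_delta]
      exact toGroup_mem _)⟩

/-- Two positive braids have a greatest lower bound for the prefix order on the braid group. -/
theorem exists_prefix_meet {s t : BraidGroup n} (hs : s ∈ PosBraid n) (ht : t ∈ PosBraid n) :
    ∃ d, PrefixLE n d s ∧ PrefixLE n d t ∧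
      ∀ c, PrefixLE n c s → PrefixLE n c t → PrefixLE n c d := by
  suffices ∀ l : ℕ, ∀ d ∈ PosBraid n, ∀ y, d * toGroup n y = s → len y ≤ l → PrefixLE n d t →
      ∃ d, PrefixLE n d s ∧ PrefixLE n d t ∧
        ∀ c, PrefixLE n c s → PrefixLE n c t → PrefixLE n c d by
    obtain ⟨w, rfl⟩ := mem_posBraid_iff.1 hs
    exact this _ 1 (one_mem _) w (one_mul _) le_rfl (one_prefixLE_iff.2 ht)
  intro l
  induction l with
  | zero =>
    intro d hd y hy hl hdt
    obtain rfl : y = 1 := eq_one_of_len_eq_zero (by omega)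
    obtain rfl : d = s := by rwa [map_one, mul_one] at hy
    exact ⟨d, .refl _, hdt, fun c hc _ => hc⟩
  | succ l ih =>
    intro d hd y hy hl hdt
    have hds : PrefixLE n d s := ⟨_, toGroup_mem y, hy⟩
    by_cases h : ∀ c, PrefixLE n c s → PrefixLE n c t → PrefixLE n c d
    · exact ⟨d, hds, hdt, h⟩
    push Not at h
    obtain ⟨c, hcs, hct, hcd⟩ := h
    obtain ⟨x, hxc, hxd⟩ := exists_prefixLE_of_mem hd c
    obtain ⟨m, hdm, hcm, hm⟩ := exists_isPrefixJoin hxd hxc hds hcs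
    rcases hdm.eq_or_mul_gen with rfl | ⟨i, hi⟩
    · exact absurd hcm hcd
    obtain ⟨p, hp, hpu⟩ := hi.trans (hm s hds hcs)
    obtain ⟨y', rfl⟩ := mem_posBraid_iff.1 hp
    refine ih (d * braidGen n i) (mul_mem hd (toGroup_mem (gen i))) y' hpu ?_
      (hi.trans (hm t hdt hct))
    rw [← hy, mul_assoc, mul_right_inj, ← toGroup_gen, ← map_mul] at hpu
    rw [← toGroup_injective n hpu, len_mul, len_gen] at hl
    omega

theorem braidDelta_mul_gen (i : Fin (n - 1)) :
    braidDelta n * braidGen n i = braidGen n i.rev * braidDelta n := by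
  rw [← toGroup_delta, ← toGroup_gen, ← toGroup_gen, ← map_mul, ← map_mul, delta_mul_gen]

theorem delta_conj_mem {p : BraidGroup n} (hp : p ∈ PosBraid n) :
    braidDelta n * p * (braidDelta n)⁻¹ ∈ PosBraid n := by
  have : PosBraid n ≤ (PosBraid n).comap (MulAut.conj (braidDelta n)).toMonoidHom := by
    refine Submonoid.closure_le.2 ?_
    rintro _ ⟨i, rfl⟩
    change braidDelta n * braidGen n i * (braidDelta n)⁻¹ ∈ PosBraid n
    rw [braidDelta_mul_gen, mul_inv_cancel_right]
    exact toGroup_mem (gen i.rev)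
  exact this hp

theorem delta_inv_conj_mem {p : BraidGroup n} (hp : p ∈ PosBraid n) :
    (braidDelta n)⁻¹ * p * braidDelta n ∈ PosBraid n := by
  have h := delta_conj_mem hp
  have hc := (commute_braidDelta_sq p).eq
  have : (braidDelta n)⁻¹ * p * braidDelta n = braidDelta n * p * (braidDelta n)⁻¹ := by
    rw [mul_assoc, inv_mul_eq_iff_eq_mul, ← mul_assoc, ← mul_assoc, eq_mul_inv_iff_mul_eq,
      mul_assoc, ← pow_two, hc]
  rwa [this]

theorem delta_zpow_conj_mem (j : ℤ) {p : BraidGroup n} (hp : p ∈ PosBraid n) :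
    braidDelta n ^ j * p * (braidDelta n ^ j)⁻¹ ∈ PosBraid n := by
  induction j with
  | zero => simpa using hp
  | succ k ih =>
    have := delta_conj_mem ih
    rw [add_comm, zpow_add, zpow_one]
    simpa only [mul_inv_rev, mul_assoc] using this
  | pred k ih =>
    have := delta_inv_conj_mem ih
    rw [sub_eq_neg_add, zpow_add, zpow_neg_one]
    simpa only [mul_inv_rev, inv_inv, mul_assoc] using this

theorem infGE_conj_iff {j : ℤ} {a s : BraidGroup n} :
    InfGE n j (s⁻¹ * a * s) ↔ PrefixLE n (a⁻¹ * (s * braidDelta n ^ j)) s := by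
  refine exists_congr fun p => and_congr_right fun _ => ?_
  rw [mul_assoc a⁻¹, inv_mul_eq_iff_eq_mul, mul_assoc s⁻¹, inv_mul_eq_iff_eq_mul, mul_assoc s]
  exact eq_comm

/-- Property `P(δ,J)` passes to greatest lower bounds for the prefix order. -/
theorem PropP.meet {r : ℕ} {J : Fin r → ℤ} {δ : Fin r → BraidGroup n} {s t d : BraidGroup n}
    (hs : PropP n r J δ s) (ht : PropP n r J δ t) (hds : PrefixLE n d s) (hdt : PrefixLE n d t)
    (hd : ∀ c, PrefixLE n c s → PrefixLE n c t → PrefixLE n c d) : PropP n r J δ d := by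
  have key : ∀ (j : ℤ) (a : BraidGroup n) {u : BraidGroup n}, PrefixLE n d u →
      PrefixLE n (a * (d * braidDelta n ^ j)) (a * (u * braidDelta n ^ j)) := by
    rintro j a _ ⟨p, hp, rfl⟩
    refine PrefixLE.mul_left ?_ a
    have := delta_zpow_conj_mem (-j) hp
    rw [zpow_neg, inv_inv] at this
    exact ⟨_, this, by group⟩
  intro i
  exact infGE_conj_iff.2 (hd _ ((key _ _ hds).trans (infGE_conj_iff.1 (hs i)))
    ((key _ _ hdt).trans (infGE_conj_iff.1 (ht i))))

theorem MinSimple.exists_gen_prefixLE {r : ℕ} {J : Fin r → ℤ} {δ : Fin r → BraidGroup n}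
    {s : BraidGroup n} (hs : MinSimple n r J δ s) : ∃ i, PrefixLE n (braidGen n i) s := by
  simpa using (one_prefixLE_iff.2 hs.1.1).eq_or_mul_gen.resolve_left hs.2.1

theorem MinSimple.eq_of_gen_prefixLE {r : ℕ} {J : Fin r → ℤ} {δ : Fin r → BraidGroup n}
    {s t : BraidGroup n} (hs : MinSimple n r J δ s) (ht : MinSimple n r J δ t) {i : Fin (n - 1)}
    (his : PrefixLE n (braidGen n i) s) (hit : PrefixLE n (braidGen n i) t) : s = t := by
  obtain ⟨d, hds, hdt, hd⟩ := exists_prefix_meet hs.1.1 ht.1.1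
  have hi : PrefixLE n (braidGen n i) d := hd _ his hit
  have hP := hs.2.2.1.meet ht.2.2.1 hds hdt hd
  have hpos : PrefixLE n 1 (braidGen n i) := one_prefixLE_iff.2 (toGroup_mem (gen i))
  have hsimple : IsSimple n d := ⟨one_prefixLE_iff.1 (hpos.trans hi), hds.trans hs.1.2⟩
  have hne : d ≠ 1 := by
    rintro rfl
    have h : toGroup n (gen i) = toGroup n 1 := (hi.antisymm hpos).trans (map_one _).symm
    exact absurd (congrArg len (toGroup_injective n h)) one_ne_zero
  exact (hs.2.2.2 d hsimple hne hP hds).symm.trans (ht.2.2.2 d hsimple hne hP hdt)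

/-- for every `J ∈ ℤ^r` and `δ ∈ C_J`, the set `S_{δ,J}` of ≼-minimal
nontrivial simple elements satisfying `P(δ,J)` has at most `n - 1` elements. -/
theorem stmt5 (n r : ℕ) (hn : 2 ≤ n) (J : Fin r → ℤ) (δ : Fin r → BraidGroup n)
    (hδ : CJ n r J δ) :
    {s | MinSimple n r J δ s}.Finite ∧ {s | MinSimple n r J δ s}.ncard ≤ n - 1 := by
  choose f hf using fun s : {s | MinSimple n r J δ s} => s.2.exists_gen_prefixLE
  have hinj : Function.Injective f := fun s t h =>
    Subtype.ext (s.2.eq_of_gen_prefixLE t.2 (hf s) (h ▸ hf t))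
  refine ⟨Set.finite_coe_iff.1 (Finite.of_injective f hinj), ?_⟩
  simpa [Nat.card_coe_set_eq] using Nat.card_le_card_of_injective f hinj
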